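/- arXiv:2207.05740 — 2 statements merged into one kernel-verified Lean document; each statement's English description precedes it below -/
import Mathlib

section
/- Let G be a finite DAG, P a distribution on finite sets factorizing according to G, and X, Y, Z arbitrary disjoint subsets of vertices with X d-separated from Y by Z. Then the marginal of P onto X ∪ Y ∪ Z satisfies the conditional independence X ⊥ Y | Z (soundness of d-separation for arbitrary disjoint triples). -/
open Classical

/-- Ancestors of a set `W` of vertices: all `u` with a directed path (possibly of
length 0) from `u` to some element of `W`. -/
def An {V : Type} (E : V → V → Prop) (W : Set V) : Set V :=
  {u | ∃ w ∈ W, Relation.ReflTransGen E u w}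

/-- Parents of a vertex `v`. -/
def Pa {V : Type} (E : V → V → Prop) (v : V) : Set V := {u | E u v}

/-- Acyclicity of a directed graph. -/
def IsAcyclicDigraph {V : Type} (E : V → V → Prop) : Prop :=
  ∀ v, ¬ Relation.TransGen E v v

/-- Marginal of a joint distribution `P` on `∏ v, X v` onto the coordinates in `S`,
evaluated at (the `S`-coordinates of) `x`. -/
noncomputable def marg {V : Type} [Fintype V] [DecidableEq V] {X : V → Type}
    [∀ v, Fintype (X v)] (P : (∀ v, X v) → ℝ) (S : Set V) (x : ∀ v, X v) : ℝ :=
  ∑ y : ∀ v, X v, if ∀ v ∈ S, y v = x v then P y else 0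

/-- Conditional independence `A ⊥ B | S` for a finite joint distribution `P`:
`P(a,b,s)·P(s) = P(a,s)·P(b,s)` for all values (phrased via marginals). -/
def CondIndep {V : Type} [Fintype V] [DecidableEq V] {X : V → Type}
    [∀ v, Fintype (X v)] (P : (∀ v, X v) → ℝ) (A B S : Set V) : Prop :=
  ∀ x : ∀ v, X v,
    marg P (A ∪ B ∪ S) x * marg P S x = marg P (A ∪ S) x * marg P (B ∪ S) x

/-- `P` factorizes according to the directed graph `E`: `P(x) = ∏ v K v (x)` for
stochastic kernels `K v` depending only on the coordinate `v` and its parents. -/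
def Factorizes {V : Type} [Fintype V] [DecidableEq V] {X : V → Type}
    [∀ v, Fintype (X v)] (E : V → V → Prop) (P : (∀ v, X v) → ℝ) : Prop :=
  ∃ K : (v : V) → (∀ u, X u) → ℝ,
    (∀ v x, 0 ≤ K v x) ∧
    (∀ v x, ∑ a : X v, K v (Function.update x v a) = 1) ∧
    (∀ v x x', x v = x' v → (∀ u, E u v → x u = x' u) → K v x = K v x') ∧
    (∀ x, P x = ∏ v, K v x)

/-- An undirected walk in the directed graph `E`. -/
def IsUWalk {V : Type} (E : V → V → Prop) (p : List V) : Prop :=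
  p.Chain' fun a b => E a b ∨ E b a

/-- An undirected path `p` is blocked by `Z` (Pearl): it contains a chain or fork
whose middle vertex is in `Z`, or a collider whose middle vertex is not an ancestor
of `Z`. -/
def Blocked {V : Type} (E : V → V → Prop) (Z : Set V) (p : List V) : Prop :=
  ∃ (i : ℕ) (a m b : V), p[i]? = some a ∧ p[i+1]? = some m ∧ p[i+2]? = some b ∧
    ((((E a m ∧ E m b) ∨ (E m a ∧ E b m) ∨ (E m a ∧ E m b)) ∧ m ∈ Z) ∨
      ((E a m ∧ E b m) ∧ m ∉ An E Z))

/-- Classical d-separation: every undirected path between `X` and `Y` is blocked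
by `Z`. -/
def DSep {V : Type} (E : V → V → Prop) (X Y Z : Set V) : Prop :=
  ∀ p : List V, IsUWalk E p → p.Nodup →
    (∃ x ∈ X, p.head? = some x) → (∃ y ∈ Y, p.getLast? = some y) → Blocked E Z p



namespace DSepAux

section Graph
variable {V : Type}

/-- Non-blocking condition on a consecutive triple. -/
def Tri (E : V → V → Prop) (Z : Set V) (a m b : V) : Prop :=
  ((E a m ∧ E b m) → m ∈ An E Z) ∧ (¬ (E a m ∧ E b m) → m ∉ Z)

/-- Unblocked walks. -/
def Good (E : V → V → Prop) (Z : Set V) : List V → Prop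
  | [] => True
  | a :: t => (∀ m ∈ t.head?, (E a m ∨ E m a) ∧ ∀ b ∈ t.tail.head?, Tri E Z a m b) ∧ Good E Z t

lemma asymm {E : V → V → Prop} (h : IsAcyclicDigraph E) {a b : V} (h1 : E a b) (h2 : E b a) :
    False := h a ((Relation.TransGen.single h1).tail h2)

lemma An_of_edge {E : V → V → Prop} {Z : Set V} {a b : V} (h1 : E a b) (h2 : b ∈ An E Z) :
    a ∈ An E Z := by
  obtain ⟨w, hw, h⟩ := h2
  exact ⟨w, hw, h.head h1⟩

lemma subset_An {E : V → V → Prop} {Z : Set V} {a : V} (h : a ∈ Z) : a ∈ An E Z :=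
  ⟨a, h, .refl⟩

lemma good_walk {E : V → V → Prop} {Z : Set V} : ∀ {p : List V}, Good E Z p → IsUWalk E p
  | [], _ => List.IsChain.nil
  | [a], _ => List.IsChain.singleton a
  | a :: m :: t, h => by
      have ih := good_walk h.2
      have h1 := (h.1 m (by simp)).1
      unfold IsUWalk at *
      exact List.isChain_cons_cons.2 ⟨h1, ih⟩

lemma good_not_blocked {E : V → V → Prop} {Z : Set V} (hE : IsAcyclicDigraph E) :
    ∀ {p : List V}, Good E Z p → ¬ Blocked E Z p := by
  intro p
  induction p with
  | nil => rintro _ ⟨i, a, m, b, h, _⟩; simp at h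
  | cons a t ih =>
    rintro hg ⟨i, a', m, b, h1, h2, h3, h4⟩
    cases i with
    | zero =>
      simp only [List.getElem?_cons_zero, Option.some.injEq] at h1
      subst h1
      simp only [List.getElem?_cons_succ] at h2 h3
      have hm : m ∈ t.head? := by cases t <;> simp_all
      have hb : b ∈ t.tail.head? := by
        cases t with
        | nil => simp at h2
        | cons c s => cases s <;> simp_all
      have T := (hg.1 m hm).2 b hb
      rcases h4 with ⟨h5, h6⟩ | ⟨h5, h6⟩
      · refine T.2 ?_ h6
        rintro ⟨e1, e2⟩
        rcases h5 with h | h | h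
        · exact asymm hE h.2 e2
        · exact asymm hE h.1 e1
        · exact asymm hE h.1 e1
      · exact h6 (T.1 h5)
    | succ i =>
      exact ih hg.2 ⟨i, a', m, b, by simpa using h1, by simpa using h2, by simpa using h3, h4⟩

lemma good_suffix {E : V → V → Prop} {Z : Set V} : ∀ {l s : List V}, Good E Z (l ++ s) → Good E Z s
  | [], _, h => h
  | _ :: l, s, h => good_suffix (l := l) h.2

lemma good_tri {E : V → V → Prop} {Z : Set V} {l s : List V} {a v b : V}
    (h : Good E Z (l ++ a :: v :: b :: s)) : Tri E Z a v b :=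
  ((good_suffix h).1 v (by simp)).2 b (by simp)

lemma good_join {E : V → V → Prop} {Z : Set V} {v : V} {s l3 : List V} :
    ∀ {l1 : List V}, Good E Z (l1 ++ v :: s) → Good E Z (v :: l3) →
      (∀ a ∈ l1.getLast?, ∀ b ∈ l3.head?, Tri E Z a v b) → Good E Z (l1 ++ v :: l3)
  | [], _, h, _ => h
  | [a], h, h', hj => by
      refine ⟨?_, h'⟩
      intro m hm
      have hm' : v = m := by simpa using hm
      subst hm'
      exact ⟨(h.1 v (by simp)).1, fun b hb => hj a (by simp) b (by simpa using hb)⟩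
  | a :: a' :: l, h, h', hj => by
      refine ⟨?_, good_join (l1 := a' :: l) h.2 h' ?_⟩
      · intro m hm
        have := h.1 m (by simpa using hm)
        refine ⟨this.1, fun b hb => this.2 b ?_⟩
        cases l <;> simpa using hb
      · intro c hc
        exact hj c (by simpa using hc)

lemma good_chain {E : V → V → Prop} {Z : Set V} :
    ∀ {s : List V} {u m : V}, Good E Z (u :: m :: s) → E u m → u ∉ An E Z →
      List.IsChain E (u :: m :: s)
  | [], u, m, _, e, _ => by simpa using e
  | b :: s, u, m, h, e, hu => by
      have hm : m ∉ An E Z := fun hm => hu (An_of_edge e hm)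
      have T := (h.1 m (by simp)).2 b (by simp)
      have hadj := (h.2.1 b (by simp)).1
      have e' : E m b := by
        rcases hadj with h1 | h1
        · exact h1
        · exact absurd (T.1 ⟨e, h1⟩) hm
      exact List.isChain_cons_cons.2 ⟨e, good_chain h.2 e' hm⟩

lemma chain_trans {E : V → V → Prop} : ∀ {l s : List V} {u v : V},
    List.IsChain E (u :: (l ++ v :: s)) → Relation.TransGen E u v
  | [], s, u, v, h => .single (List.isChain_cons_cons.1 h).1
  | a :: l, s, u, v, h => by
      have h' := List.isChain_cons_cons.1 h
      exact .head h'.1 (chain_trans (l := l) h'.2)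

lemma good_shorten {E : V → V → Prop} {Z : Set V} (hE : IsAcyclicDigraph E)
    {l1 l2 l3 : List V} {v : V} (h : Good E Z (l1 ++ v :: (l2 ++ v :: l3))) :
    Good E Z (l1 ++ v :: l3) := by
  have hv : Good E Z (v :: (l2 ++ v :: l3)) := good_suffix h
  have h3 : Good E Z (v :: l3) := good_suffix (l := v :: l2) hv
  refine good_join h h3 ?_
  intro a ha b hb
  obtain ⟨l1', rfl⟩ : ∃ l, l1 = l ++ [a] := by
    obtain ⟨hne, h'⟩ := List.mem_getLast?_eq_getLast ha
    exact ⟨l1.dropLast, by rw [h']; exact (List.dropLast_append_getLast hne).symm⟩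
  obtain ⟨l3', rfl⟩ : ∃ l, l3 = b :: l := by
    cases l3 with
    | nil => simp at hb
    | cons c l => exact ⟨l, by simp at hb; rw [hb]⟩
  obtain ⟨m, s, hs⟩ : ∃ m s, l2 ++ v :: b :: l3' = m :: s := by
    cases l2 with
    | nil => exact ⟨_, _, rfl⟩
    | cons c l => exact ⟨_, _, rfl⟩
  have T1 : Tri E Z a v m := by
    rw [hs] at h
    exact good_tri (l := l1') (s := s) (by simpa using h)
  constructor
  · rintro ⟨e1, e2⟩
    by_contra hAn
    have hadj := (hv.1 m (by simp [hs])).1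
    rcases hadj with e | e
    · have : List.IsChain E (v :: (l2 ++ v :: b :: l3')) := by
        rw [hs] at hv ⊢
        exact good_chain hv e hAn
      exact hE v (chain_trans this)
    · exact hAn (T1.1 ⟨e1, e⟩)
  · intro hn
    by_cases e1 : E a v
    · have e2 : ¬ E b v := fun e2 => hn ⟨e1, e2⟩
      obtain ⟨l, c, hl⟩ : ∃ l c, v :: l2 = l ++ [c] :=
        ⟨(v :: l2).dropLast, (v :: l2).getLast (by simp),
          (List.dropLast_append_getLast (by simp)).symm⟩
      have T2 : Tri E Z c v b := by
        have h' : Good E Z ((v :: l2) ++ v :: b :: l3') := hv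
        rw [hl] at h'
        exact good_tri (l := l) (s := l3') (by simpa using h')
      exact T2.2 fun h => e2 h.2
    · exact T1.2 fun h => e1 h.1

lemma exists_nodup {E : V → V → Prop} {Z : Set V} (hE : IsAcyclicDigraph E) (x y : V) :
    ∀ (n : ℕ) (p : List V), p.length = n → Good E Z p → p.head? = some x → p.getLast? = some y →
    ∃ q : List V, Good E Z q ∧ q.Nodup ∧ q.head? = some x ∧ q.getLast? = some y := by
  intro n
  induction n using Nat.strong_induction_on with
  | _ n ih =>
    intro p hp hg hx hy
    by_cases hn : p.Nodup
    · exact ⟨p, hg, hn, hx, hy⟩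
    · obtain ⟨v, hv⟩ := List.exists_duplicate_iff_not_nodup.2 hn
      have hsub := List.duplicate_iff_sublist.1 hv
      obtain ⟨l1, l2, l3, rfl⟩ : ∃ l1 l2 l3, p = l1 ++ v :: (l2 ++ v :: l3) := by
        obtain ⟨r1, r2, rfl, h1, h2⟩ := List.cons_sublist_iff.1 hsub
        obtain ⟨a, b, rfl⟩ := List.append_of_mem h1
        obtain ⟨c, d, rfl⟩ := List.append_of_mem (List.singleton_sublist.1 h2)
        exact ⟨a, b ++ c, d, by simp⟩
      refine ih _ ?_ (l1 ++ v :: l3) rfl (good_shorten hE hg) ?_ ?_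
      · subst hp; simp
      · rw [← hx]; cases l1 <;> simp
      · rw [← hy]; simp [List.getLast?_append, List.getLast?_cons]

/-- `v :: t` is an unblocked walk ending in `Y`. -/
def W (E : V → V → Prop) (Y Z : Set V) (v : V) (t : List V) : Prop :=
  Good E Z (v :: t) ∧ ∃ y ∈ Y, (v :: t).getLast? = some y

lemma W_cons {E : V → V → Prop} {Y Z : Set V} {v w : V} {t : List V} (h : W E Y Z v t)
    (hadj : E w v ∨ E v w) (hT : ∀ b ∈ t.head?, Tri E Z w v b) : W E Y Z w (v :: t) := by
  refine ⟨⟨?_, h.1⟩, ?_⟩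
  · intro m hm
    simp only [List.head?_cons, Option.mem_def, Option.some.injEq] at hm
    subst hm
    exact ⟨hadj, fun b hb => hT b (by simpa using hb)⟩
  · obtain ⟨y, hy, h'⟩ := h.2
    exact ⟨y, hy, by rw [← h']; simp [List.getLast?_cons]⟩

lemma no_walk {E : V → V → Prop} {X Y Z : Set V} (hE : IsAcyclicDigraph E) (hs : DSep E X Y Z)
    {v : V} {t : List V} (h : W E Y Z v t) : v ∉ X := by
  intro hv
  obtain ⟨hg, y, hy, hl⟩ := h
  obtain ⟨q, h1, h2, h3, h4⟩ := exists_nodup hE v y _ _ rfl hg rfl hl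
  exact good_not_blocked hE h1 (hs q (good_walk h1) h2 ⟨v, hv, h3⟩ ⟨y, hy, h4⟩)

lemma desc_X {E : V → V → Prop} {X Y Z : Set V} (hE : IsAcyclicDigraph E) (hs : DSep E X Y Z)
    {v x : V} (hx : x ∈ X) (hp : Relation.ReflTransGen E v x) :
    v ∉ An E Z → ∀ t, ¬ W E Y Z v t := by
  induction hp using Relation.ReflTransGen.head_induction_on with
  | refl => intro _ t h; exact no_walk hE hs h hx
  | head e hrest ih =>
    rename_i a c
    intro ha t h
    refine ih (fun hc => ha (An_of_edge e hc)) (a :: t) (W_cons h (Or.inr e) ?_)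
    intro b _
    exact ⟨fun h => (asymm hE e h.1).elim, fun _ hz => ha (subset_An hz)⟩

lemma desc_Y {E : V → V → Prop} {Y Z : Set V} (hE : IsAcyclicDigraph E)
    {v y : V} (hy : y ∈ Y) (hp : Relation.ReflTransGen E v y) :
    v ∉ An E Z → ∃ t, W E Y Z v t ∧ ∀ m ∈ t.head?, E v m := by
  induction hp using Relation.ReflTransGen.head_induction_on with
  | refl => intro _; exact ⟨[], ⟨⟨by simp, trivial⟩, y, hy, rfl⟩, by simp⟩
  | head e hrest ih =>
    rename_i a c
    intro ha
    have hc : c ∉ An E Z := fun hc => ha (An_of_edge e hc)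
    obtain ⟨t, ht, ho⟩ := ih hc
    refine ⟨c :: t, W_cons ht (Or.inl e) ?_, by simpa using e⟩
    intro b hb
    exact ⟨fun h => (asymm hE (ho b hb) h.2).elim, fun _ hz => hc (subset_An hz)⟩

/-- moving against an edge `w → v`; needs the noncollider case handled by `v ∉ Z` -/
lemma step_up {E : V → V → Prop} {X Y Z : Set V} (hE : IsAcyclicDigraph E) (hs : DSep E X Y Z)
    {v w : V} (hvA : v ∈ An E (X ∪ Y ∪ Z)) {t : List V} (h : W E Y Z v t)
    (hz : v ∈ Z → ∀ b ∈ t.head?, E b v) (e : E w v) : ∃ t, W E Y Z w t := by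
  by_cases hA : v ∈ An E Z
  · refine ⟨v :: t, W_cons h (Or.inl e) ?_⟩
    intro b hb
    exact ⟨fun _ => hA, fun hn hv => hn ⟨e, hz hv b hb⟩⟩
  · obtain ⟨u, (hu | hu) | hu, hp⟩ := hvA
    · exact (desc_X hE hs hu hp hA t h).elim
    · obtain ⟨t, ht, ho⟩ := desc_Y hE hu hp hA
      refine ⟨v :: t, W_cons ht (Or.inl e) ?_⟩
      intro b hb
      exact ⟨fun h => (asymm hE (ho b hb) h.2).elim, fun _ hz => hA (subset_An hz)⟩
    · exact (hA ⟨u, hu, hp⟩).elim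

lemma step_down {E : V → V → Prop} {Y Z : Set V} (hE : IsAcyclicDigraph E)
    {v w : V} {t : List V} (h : W E Y Z v t) (hz : v ∉ Z) (e : E v w) : W E Y Z w (v :: t) :=
  W_cons h (Or.inr e) fun _ _ => ⟨fun h => (asymm hE e h.1).elim, fun _ => hz⟩

lemma closure {E : V → V → Prop} {X Y Z : Set V} (hE : IsAcyclicDigraph E) (hs : DSep E X Y Z)
    {v u w : V} (hv : v ∈ An E (X ∪ Y ∪ Z)) (hu : u = v ∨ E u v) (hw : w = v ∨ E w v)
    (huZ : u ∉ Z) (h : ∃ t, W E Y Z u t) : ∃ t, W E Y Z w t := by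
  obtain ⟨t, h⟩ := h
  rcases hu with rfl | hu
  · rcases hw with rfl | hw
    · exact ⟨t, h⟩
    · exact step_up hE hs hv h (fun h => absurd h huZ) hw
  · have h' := step_down hE h huZ hu
    rcases hw with rfl | hw
    · exact ⟨_, h'⟩
    · exact step_up hE hs hv h' (fun _ b hb => by simp at hb; exact hb ▸ hu) hw

end Graph

section Prob
variable {V : Type} [Fintype V] [DecidableEq V] {X : V → Type} [∀ v, Fintype (X v)]

lemma sum_split (v : V) (x : ∀ v, X v) (f : (∀ v, X v) → ℝ) :
    ∑ y, f y = ∑ y, if y v = x v then ∑ a, f (Function.update y v a) else 0 := by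
  rw [← Finset.sum_filter, ← Finset.sum_product']
  refine Finset.sum_bij' (fun y _ => (Function.update y v (x v), y v))
    (fun q _ => Function.update q.1 v q.2) ?_ ?_ ?_ ?_ ?_
  · intro y _; simp
  · intro y _; simp
  · intro y _; simp
  · rintro ⟨y, a⟩ h
    simp at h
    simp [← h]
  · intro y _; simp

/-- Sum of `F` over configurations agreeing with `x` on `S`. -/
noncomputable def Q (F : (∀ v, X v) → ℝ) (S : Set V) (x : ∀ v, X v) : ℝ :=
  ∑ y : ∀ v, X v, if ∀ v ∈ S, y v = x v then F y else 0

lemma Q_eq (F : (∀ v, X v) → ℝ) (S : Set V) (x : ∀ v, X v) :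
    Q F S x = ∑ y ∈ Finset.univ.filter (fun y => ∀ v ∈ S, y v = x v), F y := by
  unfold Q
  rw [Finset.sum_filter]

lemma Q_prod (R Z T : Set V) (hZ : Z ⊆ T) (x : ∀ v, X v) (f g : (∀ v, X v) → ℝ)
    (hf : ∀ y y', (∀ v ∈ R ∪ Z, y v = y' v) → f y = f y')
    (hg : ∀ y y', (∀ v ∈ Rᶜ, y v = y' v) → g y = g y') :
    Q (fun y => f y * g y) T x = Q f (T ∪ Rᶜ) x * Q g (T ∪ R) x := by
  rw [Q_eq, Q_eq, Q_eq]
  rw [Finset.sum_mul_sum, ← Finset.sum_product']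
  refine Finset.sum_bij' (fun y _ => (fun v => if v ∈ R then y v else x v,
      fun v => if v ∈ R then x v else y v))
    (fun q _ => fun v => if v ∈ R then q.1 v else q.2 v) ?_ ?_ ?_ ?_ ?_
  · intro y h
    simp only [Finset.mem_filter, Finset.mem_univ, true_and, Finset.mem_product] at h ⊢
    refine ⟨?_, ?_⟩
    · rintro v (hv | hv)
      · simp [h v hv]
      · exact if_neg hv
    · rintro v (hv | hv)
      · simp [h v hv]
      · exact if_pos hv
  · rintro ⟨y, y'⟩ h
    simp only [Finset.mem_filter, Finset.mem_univ, true_and, Finset.mem_product] at h ⊢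
    intro v hv
    rw [h.1 v (Or.inl hv), h.2 v (Or.inl hv)]; exact ite_self _
  · intro y h
    funext v
    by_cases hv : v ∈ R <;> simp [hv]
  · rintro ⟨y, y'⟩ h
    simp only [Finset.mem_filter, Finset.mem_univ, true_and, Finset.mem_product] at h
    refine Prod.ext ?_ ?_
    · funext v
      by_cases hv : v ∈ R
      · simp [hv]
      · simp [hv, h.1 v (Or.inr hv)]
    · funext v
      by_cases hv : v ∈ R
      · simp [hv, h.2 v (Or.inr hv)]
      · simp [hv]
  · intro y h
    simp only [Finset.mem_filter, Finset.mem_univ, true_and] at h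
    congr 1
    · apply hf
      rintro v (hv | hv)
      · simp [hv]
      · simp [h v (hZ hv)]
    · apply hg
      intro v hv
      have hv' : v ∉ R := hv
      simp [hv']

lemma Q_insert (E : V → V → Prop) (hE : IsAcyclicDigraph E) (K : (v : V) → (∀ u, X u) → ℝ)
    (h1 : ∀ v x, ∑ a : X v, K v (Function.update x v a) = 1)
    (hK : ∀ v x x', x v = x' v → (∀ u, E u v → x u = x' u) → K v x = K v x')
    (A : Finset V) (hA : ∀ u v, E u v → v ∈ A → u ∈ A) (v : V) (hv : v ∉ A)
    (S : Set V) (hS : S ⊆ A) (x : ∀ v, X v) :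
    Q (fun y => ∏ u ∈ insert v A, K u y) (S ∪ {u | u ∉ insert v A}) x
      = Q (fun y => ∏ u ∈ A, K u y) (S ∪ {u | u ∉ A}) x := by
  unfold Q
  rw [sum_split v x]
  refine Finset.sum_congr rfl fun y _ => ?_
  by_cases hy : ∀ u ∈ S ∪ {u | u ∉ A}, y u = x u
  · rw [if_pos hy, if_pos (hy v (Or.inr hv))]
    have key : ∀ a, (if ∀ u ∈ S ∪ {u | u ∉ insert v A}, Function.update y v a u = x u then
        ∏ u ∈ insert v A, K u (Function.update y v a) else 0)
        = K v (Function.update y v a) * ∏ u ∈ A, K u y := by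
      intro a
      rw [if_pos, Finset.prod_insert hv]
      · congr 1
        refine Finset.prod_congr rfl fun u hu => ?_
        have huv : u ≠ v := fun h => hv (h ▸ hu)
        apply hK
        · simp [huv]
        · intro w hw
          have : w ≠ v := fun h => hv (h ▸ hA w u hw hu)
          simp [this]
      · rintro u (hu | hu)
        · have huv : u ≠ v := fun h => hv (h ▸ hS hu)
          simp [huv, hy u (Or.inl hu)]
        · simp only [Set.mem_ofPred_eq, Finset.mem_insert, not_or] at hu
          simp [hu.1, hy u (Or.inr hu.2)]
    refine (Finset.sum_congr rfl fun a _ => Eq.trans (by congr) (key a)).trans ?_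
    rw [← Finset.sum_mul, h1, one_mul]
  · rw [if_neg hy]
    by_cases hyv : y v = x v
    · rw [if_pos hyv]
      refine Finset.sum_eq_zero fun a _ => if_neg fun h => hy ?_
      intro u hu
      by_cases huv : u = v
      · rw [huv, hyv]
      · have := h u (by
          rcases hu with hu | hu
          · exact Or.inl hu
          · exact Or.inr (by simpa [huv] using hu))
        simpa [huv] using this
    · rw [if_neg hyv]

lemma exists_next (E : V → V → Prop) (hE : IsAcyclicDigraph E) (A : Finset V)
    (hne : A ≠ Finset.univ) : ∃ v ∉ A, ∀ u, E u v → u ∈ A := by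
  have : IsStrictOrder V (Relation.TransGen E) :=
    { irrefl := hE, trans := fun _ _ _ => Relation.TransGen.trans }
  have wf : WellFounded (Relation.TransGen E) := Finite.wellFounded_of_trans_of_irrefl _
  obtain ⟨w, hw⟩ : ∃ w, w ∉ A := by
    by_contra h
    push Not at h
    exact hne (Finset.eq_univ_iff_forall.2 h)
  obtain ⟨v, hv, hmin⟩ := wf.has_min {v | v ∉ A} ⟨w, hw⟩
  refine ⟨v, hv, fun u hu => ?_⟩
  by_contra h
  exact hmin u h (.single hu)

lemma Q_anc (E : V → V → Prop) (hE : IsAcyclicDigraph E) (K : (v : V) → (∀ u, X u) → ℝ)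
    (h1 : ∀ v x, ∑ a : X v, K v (Function.update x v a) = 1)
    (hK : ∀ v x x', x v = x' v → (∀ u, E u v → x u = x' u) → K v x = K v x')
    (S : Set V) (x : ∀ v, X v) :
    ∀ (n : ℕ) (A : Finset V), Aᶜ.card = n → (∀ u v, E u v → v ∈ A → u ∈ A) → S ⊆ A →
    Q (fun y => ∏ u, K u y) S x = Q (fun y => ∏ u ∈ A, K u y) (S ∪ {u | u ∉ A}) x := by
  intro n
  induction n with
  | zero =>
    intro A hc _ _
    have : A = Finset.univ := by simpa using hc
    subst this
    simp
  | succ n ih =>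
    intro A hc hA hS
    obtain ⟨v, hv, hp⟩ := exists_next E hE A (by rintro rfl; simp at hc)
    rw [← Q_insert E hE K h1 hK A hA v hv S hS x]
    apply ih
    · rw [Finset.compl_insert, Finset.card_erase_of_mem (by simpa using hv), hc]; rfl
    · intro u w e hw
      rcases Finset.mem_insert.1 hw with rfl | hw
      · exact Finset.mem_insert_of_mem (hp u e)
      · exact Finset.mem_insert_of_mem (hA u w e hw)
    · intro u hu
      exact Finset.mem_coe.2 (Finset.mem_insert_of_mem (hS hu))

end Prob

end DSepAux

open DSepAux

/-- Soundness of d-separation for arbitrary disjoint triples: if `X`, `Y`, `Z` are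
disjoint subsets of vertices of a finite DAG with `X` d-separated from `Y` by `Z`,
and `P` factorizes according to the DAG, then the marginal of `P` onto `X ∪ Y ∪ Z`
satisfies the conditional independence `X ⊥ Y | Z`. -/
theorem dsep_soundness {V : Type} [Fintype V] [DecidableEq V]
    {X' : V → Type} [∀ v, Fintype (X' v)] (E : V → V → Prop)
    (hacyc : IsAcyclicDigraph E)
    (X Y Z : Set V)
    (hXY : Disjoint X Y) (hXZ : Disjoint X Z) (hYZ : Disjoint Y Z)
    (hsep : DSep E X Y Z)
    (P : (∀ v, X' v) → ℝ) (hfac : Factorizes E P) :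
    CondIndep P X Y Z := by
  obtain ⟨K, -, h1, hK, hP⟩ := hfac
  obtain rfl : P = fun y => ∏ v, K v y := funext hP
  intro x
  let A : Finset V := Finset.univ.filter (· ∈ An E (X ∪ Y ∪ Z))
  have memA : ∀ v, v ∈ A ↔ v ∈ An E (X ∪ Y ∪ Z) := by intro v; simp [A]
  have hA : ∀ u v, E u v → v ∈ A → u ∈ A := by
    intro u v e hv
    rw [memA] at *
    exact An_of_edge e hv
  let R : Set V := {v | v ∈ A ∧ v ∉ Z ∧ ∃ t, W E Y Z v t}
  have hXR : X ⊆ Rᶜ := by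
    rintro v hv ⟨_, _, t, ht⟩
    exact no_walk hacyc hsep ht hv
  have hYR : Y ⊆ R := by
    intro v hv
    exact ⟨(memA v).2 (subset_An (Or.inl (Or.inr hv))), Set.disjoint_left.1 hYZ hv,
      [], ⟨⟨by simp, trivial⟩, v, hv, rfl⟩⟩
  let M : V → Prop := fun v => ∃ u ∈ R, u = v ∨ E u v
  let f : (∀ v, X' v) → ℝ := fun y => ∏ v ∈ A.filter M, K v y
  let g : (∀ v, X' v) → ℝ := fun y => ∏ v ∈ A.filter (fun v => ¬ M v), K v y
  have hfg : (fun y => ∏ v ∈ A, K v y) = fun y => f y * g y := by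
    funext y
    exact (Finset.prod_filter_mul_prod_filter_not A M _).symm
  have hf : ∀ y y', (∀ v ∈ R ∪ Z, y v = y' v) → f y = f y' := by
    intro y y' h
    refine Finset.prod_congr rfl fun v hv => ?_
    obtain ⟨hvA, u, hu, huv⟩ := Finset.mem_filter.1 hv
    have hw : ∀ w, (w = v ∨ E w v) → y w = y' w := by
      intro w hw
      apply h
      by_cases hz : w ∈ Z
      · exact Or.inr hz
      · refine Or.inl ⟨?_, hz, closure hacyc hsep ((memA v).1 hvA) huv hw hu.2.1 hu.2.2⟩
        rcases hw with rfl | hw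
        · exact hvA
        · exact hA _ _ hw hvA
    exact hK v y y' (hw v (Or.inl rfl)) fun w e => hw w (Or.inr e)
  have hg : ∀ y y', (∀ v ∈ Rᶜ, y v = y' v) → g y = g y' := by
    intro y y' h
    refine Finset.prod_congr rfl fun v hv => ?_
    obtain ⟨hvA, hM⟩ := Finset.mem_filter.1 hv
    have hw : ∀ w, (w = v ∨ E w v) → y w = y' w := fun w hw => h w fun hR => hM ⟨w, hR, hw⟩
    exact hK v y y' (hw v (Or.inl rfl)) fun w e => hw w (Or.inr e)
  have main : ∀ S : Set V, Z ⊆ S → S ⊆ X ∪ Y ∪ Z → marg (fun y => ∏ v, K v y) S x =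
      Q f (S ∪ {u | u ∉ A} ∪ Rᶜ) x * Q g (S ∪ {u | u ∉ A} ∪ R) x := by
    intro S hZS hS
    rw [← Q_prod R Z (S ∪ {u | u ∉ A}) (fun v hv => Or.inl (hZS hv)) x f g hf hg, ← hfg]
    exact Q_anc E hacyc K h1 hK S x _ A rfl hA
      fun v hv => Finset.mem_coe.2 ((memA v).2 (subset_An (hS hv)))
  rw [main (X ∪ Y ∪ Z) (by grind) (by grind), main Z (by grind) (by grind),
    main (X ∪ Z) (by grind) (by grind), main (Y ∪ Z) (by grind) (by grind)]
  have e1 : X ∪ Y ∪ Z ∪ {u | u ∉ A} ∪ Rᶜ = Y ∪ Z ∪ {u | u ∉ A} ∪ Rᶜ := by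
    ext v; have := @hXR v; simp only [Set.mem_union]; tauto
  have e2 : X ∪ Z ∪ {u | u ∉ A} ∪ Rᶜ = Z ∪ {u | u ∉ A} ∪ Rᶜ := by
    ext v; have := @hXR v; simp only [Set.mem_union]; tauto
  have e3 : X ∪ Y ∪ Z ∪ {u | u ∉ A} ∪ R = X ∪ Z ∪ {u | u ∉ A} ∪ R := by
    ext v; have := @hYR v; simp only [Set.mem_union]; tauto
  have e4 : Y ∪ Z ∪ {u | u ∉ A} ∪ R = Z ∪ {u | u ∉ A} ∪ R := by
    ext v; have := @hYR v; simp only [Set.mem_union]; tauto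
  rw [e1, e2, e3, e4]
  ring
end

section
/- For a finite DAG G and a distribution P on finite sets, the following are equivalent: (i) P factorizes according to G; (ii) P satisfies the global Markov property (d-separation implies conditional independence); (iii) P satisfies the local Markov property. -/
open Classical

section Prob
variable {V : Type} [Fintype V] [DecidableEq V] {X : V → Type} [∀ v, Fintype (X v)]

lemma marg_congr (P : (∀ v, X v) → ℝ) (S : Set V) (x x' : ∀ v, X v)
    (h : ∀ v ∈ S, x v = x' v) : marg P S x = marg P S x' := by
  unfold marg
  refine Finset.sum_congr rfl fun y _ => ?_
  have : (∀ v ∈ S, y v = x v) ↔ (∀ v ∈ S, y v = x' v) :=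
    forall₂_congr fun v hv => by rw [h v hv]
  simp only [this]

lemma marg_nonneg (P : (∀ v, X v) → ℝ) (hnn : ∀ x, 0 ≤ P x) (S : Set V) (x : ∀ v, X v) :
    0 ≤ marg P S x := by
  unfold marg
  refine Finset.sum_nonneg fun y _ => ?_
  split_ifs
  · exact hnn y
  · exact le_rfl

lemma marg_anti (P : (∀ v, X v) → ℝ) (hnn : ∀ x, 0 ≤ P x) {S T : Set V} (h : S ⊆ T)
    (x : ∀ v, X v) : marg P T x ≤ marg P S x := by
  unfold marg
  refine Finset.sum_le_sum fun y _ => ?_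
  split_ifs with h1 h2
  · exact le_rfl
  · exact absurd (fun v hv => h1 v (h hv)) h2
  · exact hnn y
  · exact le_rfl

lemma marg_univ (P : (∀ v, X v) → ℝ) (x : ∀ v, X v) : marg P Set.univ x = P x := by
  unfold marg
  rw [Finset.sum_eq_single x]
  · simp
  · intro b _ hb
    rw [if_neg]
    intro h
    exact hb (funext fun v => h v trivial)
  · simp

lemma marg_insert (P : (∀ v, X v) → ℝ) (S : Set V) (v : V) (hv : v ∉ S) (x : ∀ v, X v) :
    marg P S x = ∑ a : X v, marg P (insert v S) (Function.update x v a) := by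
  unfold marg
  rw [Finset.sum_comm]
  refine Finset.sum_congr rfl fun y _ => ?_
  rw [Finset.sum_eq_single (y v)]
  · have : (∀ u ∈ insert v S, y u = Function.update x v (y v) u) ↔ (∀ u ∈ S, y u = x u) := by
      constructor
      · intro h u hu
        have := h u (Set.mem_insert_of_mem _ hu)
        rwa [Function.update_of_ne (fun e : u = v => hv (e ▸ hu))] at this
      · rintro h u (rfl | hu)
        · simp
        · rw [Function.update_of_ne (fun e : u = v => hv (e ▸ hu))]
          exact h u hu
    simp only [this]
  · intro b _ hb
    rw [if_neg]
    intro h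
    have := h v (Set.mem_insert _ _)
    rw [Function.update_self] at this
    exact hb this.symm
  · simp

lemma marg_sum (P : (∀ v, X v) → ℝ) (S D : Set V) (hD : Disjoint S D) (x : ∀ v, X v) :
    marg P S x = ∑ y : ∀ v, X v, if ∀ v, v ∉ D → y v = x v then marg P (S ∪ D) y else 0 := by
  have : ∀ y : ∀ v, X v, (if ∀ v, v ∉ D → y v = x v then marg P (S ∪ D) y else 0) =
      ∑ z : ∀ v, X v, if (∀ v, v ∉ D → y v = x v) ∧ (∀ v ∈ S ∪ D, z v = y v) then P z else 0 := by
    intro y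
    split_ifs with h
    · unfold marg
      refine Finset.sum_congr rfl fun z _ => ?_
      by_cases h' : ∀ v ∈ S ∪ D, z v = y v
      · rw [if_pos h', if_pos ⟨h, h'⟩]
      · rw [if_neg h', if_neg fun h'' => h' h''.2]
    · refine (Finset.sum_eq_zero fun z _ => if_neg fun h' => h h'.1).symm
  simp only [this]
  rw [Finset.sum_comm]
  unfold marg
  refine Finset.sum_congr rfl fun z _ => ?_
  rw [Finset.sum_eq_single (fun v => if v ∈ D then z v else x v)]
  · refine if_congr ?_ rfl rfl
    constructor
    · intro h
      refine ⟨fun v hv => by simp [hv], ?_⟩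
      rintro v (hv | hv)
      · have : v ∉ D := fun h' => Set.disjoint_left.1 hD hv h'
        simp [this, h v hv]
      · simp [hv]
    · rintro ⟨-, h⟩ v hv
      have h1 : v ∉ D := fun h' => Set.disjoint_left.1 hD hv h'
      simpa [h1] using h v (Or.inl hv)
  · intro y _ hy
    rw [if_neg]
    rintro ⟨h1, h2⟩
    apply hy
    funext v
    by_cases hv : v ∈ D
    · simp [hv, h2 v (Or.inr hv)]
    · simp [hv, h1 v hv]
  · simp

lemma marg_eq_mono (P Q : (∀ v, X v) → ℝ) {S T : Set V} (h : S ⊆ T)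
    (hPQ : ∀ x, marg P T x = marg Q T x) (x : ∀ v, X v) : marg P S x = marg Q S x := by
  have hST : S ∪ (T \ S) = T := Set.union_diff_cancel h
  rw [marg_sum P S (T \ S) Set.disjoint_sdiff_right, marg_sum Q S (T \ S) Set.disjoint_sdiff_right]
  simp only [hST, hPQ]

lemma CondIndep.decomp {P : (∀ v, X v) → ℝ} {A B B' S : Set V} (h : CondIndep P A B S)
    (hB : B' ⊆ B) (hA : Disjoint A B) (hS : Disjoint B S) : CondIndep P A B' S := by
  intro x
  have hd1 : Disjoint (A ∪ B' ∪ S) (B \ B') := by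
    rw [Set.disjoint_left] at *
    rintro v ((h1 | h1) | h1) ⟨h2, h3⟩
    · exact hA h1 h2
    · exact h3 h1
    · exact hS h2 h1
  have hd2 : Disjoint (B' ∪ S) (B \ B') :=
    hd1.mono_left (Set.union_subset_union_left _ Set.subset_union_right)
  have e1 : A ∪ B' ∪ S ∪ (B \ B') = A ∪ B ∪ S := by
    ext v; have := @hB v; simp only [Set.mem_union, Set.mem_diff]; tauto
  have e2 : B' ∪ S ∪ (B \ B') = B ∪ S := by
    ext v; have := @hB v; simp only [Set.mem_union, Set.mem_diff]; tauto
  rw [marg_sum P _ _ hd1, marg_sum P (B' ∪ S) _ hd2, e1, e2, Finset.sum_mul, Finset.mul_sum]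
  refine Finset.sum_congr rfl fun y _ => ?_
  split_ifs with hy
  · have h1 : marg P S x = marg P S y := marg_congr _ _ _ _ fun v hv =>
      (hy v fun h' => Set.disjoint_left.1 hS h'.1 hv).symm
    have h2 : marg P (A ∪ S) x = marg P (A ∪ S) y := marg_congr _ _ _ _ fun v hv =>
      (hy v fun h' => hv.elim (fun hv => Set.disjoint_left.1 hA hv h'.1)
        (fun hv => Set.disjoint_left.1 hS h'.1 hv)).symm
    rw [h1, h2]
    exact h y
  · simp

lemma wf_of_acyclic {E : V → V → Prop} (h : IsAcyclicDigraph E) : WellFounded E := by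
  have : Std.Irrefl (Relation.TransGen E) := ⟨h⟩
  have := Finite.wellFounded_of_trans_of_irrefl (Relation.TransGen E)
  exact Subrelation.wf (fun h => Relation.TransGen.single h) this

lemma wf_flip_of_acyclic {E : V → V → Prop} (h : IsAcyclicDigraph E) :
    WellFounded (fun a b => E b a) := by
  apply wf_of_acyclic
  intro v hv
  exact h v (Relation.transGen_swap.1 hv)

/-- Marginal of a product of kernels on an ancestral set. -/
lemma marg_ancestral {E : V → V → Prop} (hac : IsAcyclicDigraph E)
    (K : (v : V) → (∀ u, X u) → ℝ)
    (hK1 : ∀ v x, ∑ a : X v, K v (Function.update x v a) = 1)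
    (hK2 : ∀ v x x', x v = x' v → (∀ u, E u v → x u = x' u) → K v x = K v x') :
    ∀ (n : ℕ) (A : Set V), Aᶜ.ncard = n → (∀ u v, E u v → v ∈ A → u ∈ A) →
      ∀ x, marg (fun x => ∏ v, K v x) A x = ∏ v, if v ∈ A then K v x else 1 := by
  intro n
  induction n with
  | zero =>
    intro A hA _ x
    have : A = Set.univ := by
      rw [Set.ncard_eq_zero (Set.toFinite _)] at hA
      simpa using hA
    subst this
    rw [marg_univ]; simp
  | succ n ih =>
    intro A hA hanc x
    have hne : (Aᶜ).Nonempty := by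
      rw [← Set.ncard_pos (Set.toFinite _)]; omega
    obtain ⟨v, hv, hmin⟩ := (wf_of_acyclic hac).has_min _ hne
    have hv' : v ∉ A := hv
    have hpar : ∀ u, E u v → u ∈ A := fun u hu => by
      by_contra h; exact hmin u h hu
    have hc : (insert v A)ᶜ.ncard = n := by
      have : (insert v A)ᶜ = Aᶜ \ {v} := by
        ext u; simp [not_or, and_comm]
      rw [this, Set.ncard_diff_singleton_of_mem hv, hA]; rfl
    rw [marg_insert _ A v hv']
    have step : ∀ a : X v, marg (fun x => ∏ v, K v x) (insert v A) (Function.update x v a) =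
        K v (Function.update x v a) * ∏ u, if u ∈ A then K u x else 1 := by
      intro a
      rw [ih _ hc]
      · rw [← Finset.mul_prod_erase Finset.univ _ (Finset.mem_univ v),
          ← Finset.mul_prod_erase Finset.univ (fun u => if u ∈ A then K u x else 1)
            (Finset.mem_univ v)]
        simp only [Set.mem_insert_iff, true_or, if_true, hv', if_false, one_mul]
        congr 1
        refine Finset.prod_congr rfl fun u hu => ?_
        have huv : u ≠ v := (Finset.mem_erase.1 hu).1
        simp only [huv, false_or]
        split_ifs with huA
        · apply hK2
          · rw [Function.update_of_ne huv]
          · intro w hw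
            rw [Function.update_of_ne]
            rintro rfl
            exact hv' (hanc _ _ hw huA)
        · rfl
      · rintro u w huw (rfl | hw)
        · exact Or.inr (hpar u huw)
        · exact Or.inr (hanc _ _ huw hw)
    simp only [step]
    rw [← Finset.sum_mul, hK1, one_mul]

/-- The swap argument. -/
lemma condIndep_swap (K : (v : V) → (∀ u, X u) → ℝ) (A B Z R : Set V)
    (hA : ∀ v ∈ A, v ∉ R) (hB : B ⊆ R) (hZ : ∀ v ∈ Z, v ∉ R)
    (hK : ∀ v, (∀ x x', (∀ u, u ∈ R ∪ Z → x u = x' u) → K v x = K v x') ∨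
      (∀ x x', (∀ u, u ∉ R → x u = x' u) → K v x = K v x')) :
    CondIndep (fun x => ∏ v, K v x) A B Z := by
  intro x
  unfold marg
  rw [Finset.sum_mul_sum, Finset.sum_mul_sum, ← Finset.sum_product', ← Finset.sum_product']
  let sw : ((∀ v, X v) × (∀ v, X v)) → ((∀ v, X v) × (∀ v, X v)) := fun p =>
    (fun v => if v ∈ R then p.2 v else p.1 v, fun v => if v ∈ R then p.1 v else p.2 v)
  have hinv : Function.Involutive sw := by
    rintro ⟨y, y'⟩
    simp only [sw]
    ext v <;> by_cases h : v ∈ R <;> simp [h]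
  refine Finset.sum_equiv hinv.toPerm (by simp) ?_
  rintro ⟨y, y'⟩ _
  simp only [Function.Involutive.coe_toPerm, sw]
  have hcond : ((∀ v ∈ A ∪ B ∪ Z, y v = x v) ∧ (∀ v ∈ Z, y' v = x v)) ↔
      ((∀ v ∈ A ∪ Z, (if v ∈ R then y' v else y v) = x v) ∧
        (∀ v ∈ B ∪ Z, (if v ∈ R then y v else y' v) = x v)) := by
    constructor
    · rintro ⟨h1, h2⟩
      constructor
      · rintro v (hv | hv)
        · simpa [hA v hv] using h1 v (Or.inl (Or.inl hv))
        · simpa [hZ v hv] using h1 v (Or.inr hv)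
      · rintro v (hv | hv)
        · simpa [hB hv] using h1 v (Or.inl (Or.inr hv))
        · simpa [hZ v hv] using h2 v hv
    · rintro ⟨h1, h2⟩
      constructor
      · rintro v ((hv | hv) | hv)
        · simpa [hA v hv] using h1 v (Or.inl hv)
        · simpa [hB hv] using h2 v (Or.inl hv)
        · simpa [hZ v hv] using h1 v (Or.inr hv)
      · intro v hv
        simpa [hZ v hv] using h2 v (Or.inr hv)
  have hmul : ∀ (p q : Prop) (_ : Decidable p) (_ : Decidable q) (a b : ℝ),
      (if p then a else 0) * (if q then b else 0) = if p ∧ q then a * b else 0 := by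
    intro p q _ _ a b
    by_cases hp : p <;> by_cases hq : q <;> simp [hp, hq]
  rw [hmul, hmul]
  refine (if_congr hcond rfl rfl).trans ?_
  split_ifs with h
  · obtain ⟨h1, h2⟩ := hcond.2 h
    rw [← Finset.prod_mul_distrib, ← Finset.prod_mul_distrib]
    refine Finset.prod_congr rfl fun v _ => ?_
    have hzz : ∀ u ∈ Z, y u = y' u := fun u hu => by rw [h1 u (Or.inr hu), h2 u hu]
    rcases hK v with hk | hk
    · rw [mul_comm]
      congr 1
      · apply hk
        rintro u (hu | hu)
        · simp [hu]
        · simp [hZ u hu, hzz u hu]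
      · apply hk
        rintro u (hu | hu)
        · simp [hu]
        · simp [hZ u hu, hzz u hu]
    · congr 1
      · apply hk
        intro u hu
        simp [hu]
      · apply hk
        intro u hu
        simp [hu]
  · rfl

end Prob

section Graph
variable {V : Type} {E : V → V → Prop}

lemma blocked_cons {Z : Set V} {a : V} {l : List V} (h : Blocked E Z l) :
    Blocked E Z (a :: l) := by
  obtain ⟨i, x, m, y, h1, h2, h3, h4⟩ := h
  exact ⟨i + 1, x, m, y, by simpa using h1, by simpa using h2, by simpa using h3, h4⟩

lemma blocked_append {Z : Set V} {s l : List V} (h : Blocked E Z l) :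
    Blocked E Z (s ++ l) := by
  induction s with
  | nil => exact h
  | cons a s ih => exact blocked_cons ih

lemma blocked_head {Z : Set V} {a m b : V} {l : List V}
    (h : (((E a m ∧ E m b) ∨ (E m a ∧ E b m) ∨ (E m a ∧ E m b)) ∧ m ∈ Z) ∨
      ((E a m ∧ E b m) ∧ m ∉ An E Z)) : Blocked E Z (a :: m :: b :: l) :=
  ⟨0, a, m, b, by simp, by simp, by simp, h⟩

lemma blocked_cons_inv {Z : Set V} {a : V} {l : List V} (h : Blocked E Z (a :: l)) :
    Blocked E Z l ∨ ∃ m b l', l = m :: b :: l' ∧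
      ((((E a m ∧ E m b) ∨ (E m a ∧ E b m) ∨ (E m a ∧ E m b)) ∧ m ∈ Z) ∨
      ((E a m ∧ E b m) ∧ m ∉ An E Z)) := by
  obtain ⟨i, x, m, y, h1, h2, h3, h4⟩ := h
  cases i with
  | zero =>
    right
    match l, h2, h3 with
    | m' :: b' :: l', h2, h3 =>
      simp at h1 h2 h3
      subst h1 h2 h3
      exact ⟨_, _, _, rfl, h4⟩
  | succ i =>
    left
    exact ⟨i, x, m, y, by simpa using h1, by simpa using h2, by simpa using h3, h4⟩

/-- Active simple path starting at `v`, ending in `Y`. -/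
structure APath (E : V → V → Prop) (Y Z : Set V) (v : V) (q : List V) : Prop where
  walk : IsUWalk E (v :: q)
  nodup : (v :: q).Nodup
  act : ¬ Blocked E Z (v :: q)
  last : ∃ y ∈ Y, (v :: q).getLast? = some y

def Dn (E : V → V → Prop) (Y Z : Set V) (v : V) : Prop :=
  ∃ q, APath E Y Z v q ∧ (v ∈ Z → ∃ w l, q = w :: l ∧ E w v)

def Up (E : V → V → Prop) (Y Z : Set V) (v : V) : Prop :=
  ∃ q, APath E Y Z v q ∧ v ∉ Z ∧ ∀ w l, q = w :: l → E w v → v ∈ An E Z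

variable {Y Z : Set V}

lemma Up.dn {v : V} (h : Up E Y Z v) : Dn E Y Z v := by
  obtain ⟨q, h1, h2, _⟩ := h
  exact ⟨q, h1, fun h => absurd h h2⟩

lemma up_start {y : V} (hy : y ∈ Y) (hz : y ∉ Z) : Up E Y Z y := by
  refine ⟨[], ⟨List.isChain_singleton _, by simp, ?_, y, hy, by simp⟩, hz, by simp⟩
  rintro ⟨i, a, m, b, _, h, _⟩
  simp at h

lemma APath.suffix {v u : V} {q s t : List V} (h : APath E Y Z v q) (e : v :: q = s ++ u :: t) :
    APath E Y Z u t := by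
  obtain ⟨h1, h2, h3, h4⟩ := h
  rw [e] at h1 h2 h3 h4
  refine ⟨?_, ?_, fun hb => h3 (blocked_append hb), ?_⟩
  · exact (List.isChain_append.1 h1).2.1
  · exact (List.nodup_append.1 h2).2.1
  · simpa using h4

lemma APath.cons {v u : V} {q : List V} (h : APath E Y Z v q) (hu : u ∉ v :: q)
    (hE : E u v ∨ E v u)
    (ht : ∀ b l, q = b :: l →
      ¬ ((((E u v ∧ E v b) ∨ (E v u ∧ E b v) ∨ (E v u ∧ E v b)) ∧ v ∈ Z) ∨
      ((E u v ∧ E b v) ∧ v ∉ An E Z))) : APath E Y Z u (v :: q) := by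
  refine ⟨List.isChain_cons_cons.2 ⟨hE, h.walk⟩, List.nodup_cons.2 ⟨hu, h.nodup⟩, ?_, ?_⟩
  · intro hb
    rcases blocked_cons_inv hb with hb | ⟨m, b, l, e, hbb⟩
    · exact h.act hb
    · cases e
      exact ht _ _ rfl hbb
  · simpa using h.last

lemma mem_an_of_rtg {u v : V} (h : Relation.ReflTransGen E u v) (hv : v ∈ An E Z) :
    u ∈ An E Z := by
  obtain ⟨w, hw, h'⟩ := hv
  exact ⟨w, hw, h.trans h'⟩

lemma asymm' (hac : IsAcyclicDigraph E) {u v : V} (h : E u v) : ¬ E v u := fun h' =>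
  hac u (.tail (.single h) h')

/-- Key lemma for loop removal. -/
lemma loop_lemma {u w : V} {l : List V} (huw : E w u) :
    ∀ (s : List V) (v : V), IsUWalk E (v :: s ++ u :: w :: l) →
      ¬ Blocked E Z (v :: s ++ u :: w :: l) →
      u ∈ An E Z ∨ (Relation.ReflTransGen E u v ∧
        ∃ t l', s ++ u :: w :: l = t :: l' ∧ E t v) := by
  intro s
  induction s with
  | nil =>
    intro v hw hb
    have hE := (List.isChain_cons_cons.1 hw).1
    rcases hE with hE | hE
    · left
      by_contra hn
      exact hb (blocked_head (Or.inr ⟨⟨hE, huw⟩, hn⟩))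
    · exact Or.inr ⟨.single hE, _, _, rfl, hE⟩
  | cons t s ih =>
    intro v hw hb
    obtain ⟨hE, hw'⟩ := List.isChain_cons_cons.1 hw
    rcases ih t hw' (fun h => hb (blocked_cons h)) with h | ⟨h1, t2, l', e, h2⟩
    · exact Or.inl h
    · rcases hE with hE | hE
      · left
        apply mem_an_of_rtg h1
        by_contra hn
        apply hb
        simp only [List.cons_append, e]
        exact blocked_head (Or.inr ⟨⟨hE, h2⟩, hn⟩)
      · exact Or.inr ⟨h1.tail hE, _, _, rfl, hE⟩

lemma Up.parent (hac : IsAcyclicDigraph E) {v u : V} (h : Up E Y Z v) (hE : E u v)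
    (hu : u ∉ Z) : Up E Y Z u := by
  obtain ⟨q, hq, hvZ, hup⟩ := h
  by_cases hm : u ∈ v :: q
  · obtain ⟨s, t, e⟩ := List.append_of_mem hm
    refine ⟨t, hq.suffix e, hu, ?_⟩
    rintro w l rfl hwu
    cases s with
    | nil =>
      simp at e
      exact absurd hE (e.1 ▸ fun h => hac _ (.single h))
    | cons v' s =>
      have ev : v = v' := by simpa using congrArg List.head? e
      subst ev
      have eq : q = s ++ u :: w :: l := by simpa using e
      subst eq
      rcases loop_lemma hwu s v hq.walk hq.act with h | ⟨h1, t, l', e', h2⟩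
      · exact h
      · exact mem_an_of_rtg h1 (hup _ _ e' h2)
  · refine ⟨v :: q, hq.cons hm (Or.inl hE) ?_, hu, ?_⟩
    · rintro b l e (⟨-, h⟩ | ⟨⟨_, h⟩, h'⟩)
      · exact hvZ h
      · exact h' (hup _ _ e h)
    · rintro w l e hw
      cases e
      exact absurd hw (asymm' hac hE)

lemma Dn.parent (hac : IsAcyclicDigraph E) {v u : V} (h : Dn E Y Z v) (hv : v ∈ An E Z)
    (hE : E u v) (hu : u ∉ Z) : Up E Y Z u := by
  obtain ⟨q, hq, hJ⟩ := h
  have huA : u ∈ An E Z := mem_an_of_rtg (.single hE) hv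
  by_cases hm : u ∈ v :: q
  · obtain ⟨s, t, e⟩ := List.append_of_mem hm
    exact ⟨t, hq.suffix e, hu, fun _ _ _ _ => huA⟩
  · refine ⟨v :: q, hq.cons hm (Or.inl hE) ?_, hu, fun _ _ _ _ => huA⟩
    rintro b l e (⟨h, hz⟩ | ⟨_, h'⟩)
    · obtain ⟨w, l', e', hw⟩ := hJ hz
      rw [e] at e'
      cases e'
      rcases h with h | h | h
      · exact asymm' hac hw h.2
      · exact asymm' hac hE h.1
      · exact asymm' hac hE h.1
    · exact h' hv

lemma Dn.child (hac : IsAcyclicDigraph E) (hYZ : Disjoint Y Z) {v u : V} (h : Dn E Y Z v)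
    (hv : v ∉ Z) (hE : E v u) : Dn E Y Z u := by
  obtain ⟨q, hq, hJ⟩ := h
  by_cases hm : u ∈ v :: q
  · obtain ⟨s, t, e⟩ := List.append_of_mem hm
    have ht := hq.suffix e
    refine ⟨t, ht, fun huZ => ?_⟩
    cases t with
    | nil =>
      obtain ⟨y, hy, e⟩ := ht.last
      simp at e
      exact absurd huZ (Set.disjoint_left.1 hYZ (e ▸ hy))
    | cons w l =>
      refine ⟨w, l, rfl, ?_⟩
      by_contra hn
      have hw : E u w := ((List.isChain_cons_cons.1 ht.walk).1).resolve_right hn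
      rcases List.eq_nil_or_concat s with rfl | ⟨s', a, rfl⟩
      · simp at e
        exact hac v (.single (by rw [← e.1] at hE; exact hE))
      · have e2 : v :: q = s' ++ (a :: u :: w :: l) := by simpa using e
        have ha := hq.suffix e2
        have hE' := (List.isChain_cons_cons.1 ha.walk).1
        apply ha.act
        apply blocked_head
        left
        refine ⟨?_, huZ⟩
        tauto
  · refine ⟨v :: q, hq.cons hm (Or.inr hE) ?_, fun _ => ⟨v, q, rfl, hE⟩⟩
    rintro b l e (⟨_, h⟩ | ⟨⟨h, _⟩, _⟩)
    · exact hv h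
    · exact asymm' hac hE h

lemma dsep_not_dn {X : Set V} (h : DSep E X Y Z) {x : V} (hx : x ∈ X) : ¬ Dn E Y Z x := by
  rintro ⟨q, hq, _⟩
  exact hq.act (h _ hq.walk hq.nodup ⟨x, hx, by simp⟩ hq.last)

lemma family_closed (hac : IsAcyclicDigraph E) {X : Set V} (hYZ : Disjoint Y Z)
    (h : DSep E X Y Z) {v : V} (hv : v ∈ An E (X ∪ Y ∪ Z)) (hd : Dn E Y Z v) {u : V}
    (hu : E u v) (huZ : u ∉ Z) : Up E Y Z u := by
  by_cases hA : v ∈ An E Z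
  · exact hd.parent hac hA hu huZ
  have hnz : ∀ w, Relation.ReflTransGen E v w → w ∉ Z := fun w hw hz => hA ⟨w, hz, hw⟩
  obtain ⟨w, (hw | hw) | hw, hp⟩ := hv
  · exfalso
    refine dsep_not_dn h hw ?_
    clear hw
    induction hp with
    | refl => exact hd
    | tail h1 h2 ih => exact ih.child hac hYZ (hnz _ h1) h2
  · have : Up E Y Z w := up_start hw (Set.disjoint_left.1 hYZ hw)
    have key : Up E Y Z v := by
      clear hw hd hu hA
      induction hp using Relation.ReflTransGen.head_induction_on with
      | refl => exact this
      | head h1 h2 ih =>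
        exact (ih (fun w hw => hnz w (hw.head h1))).parent hac h1 (hnz _ .refl)
    exact key.parent hac hu huZ
  · exact absurd ⟨w, hw, hp⟩ hA

lemma blocked_down (hac : IsAcyclicDigraph E) {v w : V} (hnd : ¬ Relation.ReflTransGen E v w) :
    ∀ (l : List V) (a m : V), IsUWalk E (a :: m :: l) → (a :: m :: l).getLast? = some w →
      Relation.ReflTransGen E v a → E a m → Blocked E (Pa E v) (a :: m :: l) := by
  intro l
  induction l with
  | nil =>
    intro a m _ hl hva ham
    simp at hl
    exact absurd (hl ▸ hva.tail ham) hnd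
  | cons b l ih =>
    intro a m hw hl hva ham
    have hw' := (List.isChain_cons_cons.1 hw).2
    rcases (List.isChain_cons_cons.1 hw').1 with h | h
    · exact blocked_cons (ih m b hw' (by simpa using hl) (hva.tail ham) h)
    · apply blocked_head
      right
      refine ⟨⟨ham, h⟩, ?_⟩
      rintro ⟨z, hz, hmz⟩
      exact hac v (((Relation.TransGen.tail' hva ham).trans_left hmz).tail hz)

lemma dsep_local (hac : IsAcyclicDigraph E) (v : V) :
    DSep E {v} ({w | w ≠ v ∧ ¬ Relation.ReflTransGen E v w} \ Pa E v) (Pa E v) := by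
  rintro p hp - ⟨x, rfl, hx⟩ ⟨w, ⟨⟨hne, hnd⟩, hpa⟩, hw⟩
  match p, hp, hx, hw with
  | [a], hp, hx, hw =>
    simp at hx hw
    exact absurd (hw.symm.trans hx) hne
  | a :: m :: l, hp, hx, hw =>
    simp only [List.head?_cons, Option.some.injEq] at hx
    subst hx
    rcases (List.isChain_cons_cons.1 hp).1 with h | h
    · exact blocked_down hac hnd l a m hp hw .refl h
    · cases l with
      | nil =>
        simp at hw
        exact absurd (hw ▸ h) hpa
      | cons b l =>
        have h2 := (List.isChain_cons_cons.1 (List.isChain_cons_cons.1 hp).2).1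
        apply blocked_head
        left
        refine ⟨?_, h⟩
        tauto

end Graph

section Main
variable {V : Type} [Fintype V] [DecidableEq V] {X' : V → Type} [∀ v, Fintype (X' v)]

lemma global_of_factorizes {E : V → V → Prop} (hac : IsAcyclicDigraph E)
    {P : (∀ v, X' v) → ℝ} (hF : Factorizes E P) (X Y Z : Set V)
    (hXZ : Disjoint X Z) (hYZ : Disjoint Y Z) (h : DSep E X Y Z) :
    CondIndep P X Y Z := by
  obtain ⟨K, -, hK1, hK2, hP⟩ := hF
  obtain rfl : P = fun x => ∏ v, K v x := funext hP
  intro x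
  have hne : ∀ v, Nonempty (X' v) := fun v => ⟨x v⟩
  let A := An E (X ∪ Y ∪ Z)
  have hanc : ∀ u v, E u v → v ∈ A → u ∈ A := fun u v huv hv => mem_an_of_rtg (.single huv) hv
  have hsub : X ∪ Y ∪ Z ⊆ A := fun v hv => ⟨v, hv, .refl⟩
  let K' : (v : V) → (∀ u, X' u) → ℝ := fun v x =>
    if v ∈ A then K v x else (Fintype.card (X' v) : ℝ)⁻¹
  have hK1' : ∀ v x, ∑ a : X' v, K' v (Function.update x v a) = 1 := by
    intro v x
    by_cases hv : v ∈ A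
    · simp [K', hv, hK1]
    · simp [K', hv]
  have hK2' : ∀ v x x', x v = x' v → (∀ u, E u v → x u = x' u) → K' v x = K' v x' := by
    intro v x x' h1 h2
    simp only [K', hK2 v x x' h1 h2]
  have hmarg : ∀ x, marg (fun x => ∏ v, K v x) A x = marg (fun x => ∏ v, K' v x) A x := by
    intro x
    rw [marg_ancestral hac K hK1 hK2 _ A rfl hanc, marg_ancestral hac K' hK1' hK2' _ A rfl hanc]
    refine Finset.prod_congr rfl fun v _ => ?_
    by_cases hv : v ∈ A <;> simp [K', hv]
  have hm : ∀ S ⊆ X ∪ Y ∪ Z, marg (fun x => ∏ v, K v x) S x = marg (fun x => ∏ v, K' v x) S x :=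
    fun S hS => marg_eq_mono _ _ (hS.trans hsub) hmarg x
  rw [hm _ subset_rfl, hm Z Set.subset_union_right,
    hm (X ∪ Z) (Set.union_subset_union_left _ Set.subset_union_left),
    hm (Y ∪ Z) (Set.union_subset_union_left _ Set.subset_union_right)]
  let R : Set V := {v | v ∉ Z ∧ Dn E Y Z v}
  refine condIndep_swap K' X Y Z R ?_ ?_ ?_ ?_ x
  · rintro v hv ⟨_, hd⟩
    exact dsep_not_dn h hv hd
  · intro y hy
    have := Set.disjoint_left.1 hYZ hy
    exact ⟨this, (up_start hy this).dn⟩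
  · rintro v hv ⟨h, _⟩
    exact h hv
  · intro v
    by_cases hv : v ∈ A
    · by_cases hex : v ∈ R ∨ ∃ u, E u v ∧ u ∈ R
      · left
        have hd : Dn E Y Z v := by
          rcases hex with h | ⟨u, hu, h⟩
          · exact h.2
          · exact h.2.child hac hYZ h.1 hu
        intro x x' hx
        apply hK2'
        · apply hx
          by_cases hz : v ∈ Z
          · exact Or.inr hz
          · exact Or.inl ⟨hz, hd⟩
        · intro u hu
          apply hx
          by_cases hz : u ∈ Z
          · exact Or.inr hz
          · exact Or.inl ⟨hz, (family_closed hac hYZ h hv hd hu hz).dn⟩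
      · right
        push Not at hex
        intro x x' hx
        exact hK2' _ _ _ (hx _ hex.1) fun u hu => hx _ (hex.2 u hu)
    · left
      intro x x' _
      simp [K', hv]

lemma factorizes_of_local {E : V → V → Prop} (hac : IsAcyclicDigraph E)
    (P : (∀ v, X' v) → ℝ) (hnn : ∀ x, 0 ≤ P x) (hsum : ∑ x : ∀ v, X' v, P x = 1)
    (hL : ∀ v : V,
        CondIndep P {v} ({w | w ≠ v ∧ ¬ Relation.ReflTransGen E v w} \ Pa E v)
          (Pa E v)) : Factorizes E P := by
  have hvPa : ∀ v, v ∉ Pa E v := fun v h => hac v (.single h)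
  let K : (v : V) → (∀ u, X' u) → ℝ := fun v x =>
    if marg P (Pa E v) x = 0 then (Fintype.card (X' v) : ℝ)⁻¹
    else marg P (insert v (Pa E v)) x / marg P (Pa E v) x
  have main : ∀ (n : ℕ) (A : Set V), A.ncard = n → (∀ u v, E u v → v ∈ A → u ∈ A) →
      ∀ x, marg P A x = ∏ v, if v ∈ A then K v x else 1 := by
    intro n
    induction n with
    | zero =>
      intro A hA _ x
      rw [Set.ncard_eq_zero (Set.toFinite _)] at hA
      subst hA
      simpa [marg] using hsum
    | succ n ih =>
      intro A hA hanc x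
      have hne : A.Nonempty := by
        rw [← Set.ncard_pos (Set.toFinite _)]; omega
      obtain ⟨v, hv, hmax⟩ := (wf_flip_of_acyclic hac).has_min _ hne
      have hc : (A \ {v}).ncard = n := by
        rw [Set.ncard_diff_singleton_of_mem hv, hA]; rfl
      have hanc' : ∀ u w, E u w → w ∈ A \ {v} → u ∈ A \ {v} := by
        rintro u w huw ⟨hw, hwv⟩
        refine ⟨hanc u w huw hw, ?_⟩
        rintro rfl
        exact hmax w hw huw
      have hPaA : Pa E v ⊆ A \ {v} := fun u hu =>
        ⟨hanc u v hu hv, fun e : u = v => hvPa v (e ▸ hu)⟩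
      have hprod : (∏ u, if u ∈ A then K u x else 1) = K v x * marg P (A \ {v}) x := by
        rw [ih _ hc hanc']
        conv_lhs => rw [← Finset.mul_prod_erase Finset.univ _ (Finset.mem_univ v)]
        conv_rhs => rw [← Finset.mul_prod_erase Finset.univ _ (Finset.mem_univ v)]
        simp only [hv, if_true, Set.mem_sdiff, Set.mem_singleton_iff, not_true, and_false, if_false,
          one_mul]
        congr 1
        refine Finset.prod_congr rfl fun u hu => ?_
        have huv : u ≠ v := (Finset.mem_erase.1 hu).1
        simp [huv]
      rw [hprod]
      by_cases h0 : marg P (Pa E v) x = 0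
      · have z1 : marg P (A \ {v}) x = 0 :=
          le_antisymm (h0 ▸ marg_anti P hnn hPaA x) (marg_nonneg P hnn _ _)
        have z2 : marg P A x = 0 :=
          le_antisymm (h0 ▸ marg_anti P hnn (hPaA.trans Set.diff_subset) x) (marg_nonneg P hnn _ _)
        rw [z1, z2, mul_zero]
      · have hci : CondIndep P {v} ((A \ {v}) \ Pa E v) (Pa E v) := by
          refine (hL v).decomp ?_ ?_ Set.disjoint_sdiff_left
          · rintro u ⟨⟨huA, huv⟩, hup⟩
            refine ⟨⟨huv, fun hr => ?_⟩, hup⟩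
            rcases Relation.ReflTransGen.cases_head hr with e | ⟨c, hvc, hcu⟩
            · exact huv e.symm
            · have hcA : c ∈ A := by
                clear hvc hr huv hup
                induction hcu using Relation.ReflTransGen.head_induction_on with
                | refl => exact huA
                | head h1 _ ih => exact hanc _ _ h1 ih
              exact hmax c hcA hvc
          · rw [Set.disjoint_singleton_left]
            rintro ⟨⟨h, _⟩, _⟩
            exact h rfl
        have := hci x
        have e1 : {v} ∪ ((A \ {v}) \ Pa E v) ∪ Pa E v = A := by
          rw [Set.union_assoc, Set.diff_union_of_subset hPaA]
          exact Set.union_diff_cancel (Set.singleton_subset_iff.2 hv)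
        rw [e1, Set.diff_union_of_subset hPaA, Set.singleton_union] at this
        simp only [K, h0, if_false]
        field_simp
        linarith
  refine ⟨K, ?_, ?_, ?_, ?_⟩
  · intro v x
    simp only [K]
    split_ifs
    · positivity
    · exact div_nonneg (marg_nonneg P hnn _ _) (marg_nonneg P hnn _ _)
  · intro v x
    have : Nonempty (X' v) := ⟨x v⟩
    have hc : ∀ a, marg P (Pa E v) (Function.update x v a) = marg P (Pa E v) x := fun a =>
      marg_congr _ _ _ _ fun u hu => Function.update_of_ne (fun e : u = v => hvPa v (e ▸ hu)) _ _
    simp only [K, hc]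
    by_cases h0 : marg P (Pa E v) x = 0
    · simp [h0]
    · simp only [h0, if_false]
      rw [← Finset.sum_div, ← marg_insert P _ v (hvPa v), div_self h0]
  · intro v x x' h1 h2
    have e1 : marg P (Pa E v) x = marg P (Pa E v) x' := marg_congr _ _ _ _ h2
    have e2 : marg P (insert v (Pa E v)) x = marg P (insert v (Pa E v)) x' := by
      apply marg_congr
      rintro u (rfl | hu)
      · exact h1
      · exact h2 u hu
    simp only [K, e1, e2]
  · intro x
    have := main _ Set.univ rfl (fun _ _ _ _ => trivial) x
    rw [marg_univ] at this
    simpa using this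

end Main

/-- Theorem 6.11 of Fritz–Klingler instantiated in FinStoch: for a finite DAG and a
joint probability distribution `P` on finite sets, the following are equivalent:
(i) `P` factorizes according to the DAG; (ii) `P` satisfies the global Markov
property (d-separation implies conditional independence); (iii) `P` satisfies the
local Markov property. -/
theorem factorizes_iff_global_iff_local {V : Type} [Fintype V] [DecidableEq V]
    {X' : V → Type} [∀ v, Fintype (X' v)] (E : V → V → Prop)
    (hacyc : IsAcyclicDigraph E)
    (P : (∀ v, X' v) → ℝ)
    (hnn : ∀ x, 0 ≤ P x) (hsum : ∑ x : ∀ v, X' v, P x = 1) :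
    (Factorizes E P ↔
      (∀ X Y Z : Set V, Disjoint X Y → Disjoint X Z → Disjoint Y Z →
        DSep E X Y Z → CondIndep P X Y Z)) ∧
    (Factorizes E P ↔
      (∀ v : V,
        CondIndep P {v} ({w | w ≠ v ∧ ¬ Relation.ReflTransGen E v w} \ Pa E v)
          (Pa E v))) := by
  have hGL : (∀ X Y Z : Set V, Disjoint X Y → Disjoint X Z → Disjoint Y Z →
        DSep E X Y Z → CondIndep P X Y Z) → (∀ v : V,
        CondIndep P {v} ({w | w ≠ v ∧ ¬ Relation.ReflTransGen E v w} \ Pa E v)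
          (Pa E v)) := by
    intro hG v
    refine hG _ _ _ ?_ ?_ Set.disjoint_sdiff_left (dsep_local hacyc v)
    · rw [Set.disjoint_singleton_left]
      rintro ⟨⟨h, _⟩, _⟩
      exact h rfl
    · rw [Set.disjoint_singleton_left]
      exact fun h => hacyc v (.single h)
  have hFG : Factorizes E P → (∀ X Y Z : Set V, Disjoint X Y → Disjoint X Z → Disjoint Y Z →
        DSep E X Y Z → CondIndep P X Y Z) := fun hF X Y Z _ h2 h3 h =>
    global_of_factorizes hacyc hF X Y Z h2 h3 h
  have hLF := factorizes_of_local hacyc P hnn hsum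
  exact ⟨⟨hFG, fun h => hLF (hGL h)⟩, ⟨fun h => hGL (hFG h), hLF⟩⟩
end
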